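/- Define I(α) := ∫_0^1 ∫_0^∞ exp( −((2u − u²)/7)·λ² + (8α/7)·u·λ ) dλ du for α ∈ ℝ (so that I(α) = (7/4)·E[T_α] for the expected absorption time of the standard logistic branching process). Then lim_{α → −∞} ( |α| / ln|α| )·I(α) = 7/4; equivalently, E[T_α] = (4/7)·I(α) ∼ ln|α| / |α| as α → −∞. -/

import Mathlib

open MeasureTheory Filter
open scoped Topology

noncomputable section

/-- `I(α) = ∫_0^1 ∫_0^∞ exp(-((2u-u²)/7)λ² + (8α/7)uλ) dλ du`, so that
`I(α) = (7/4)·E[T_α]` for the absorption time of the standard logistic branching process. -/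
def absorptionIntegral (α : ℝ) : ℝ :=
  ∫ u in (0 : ℝ)..1, ∫ l in Set.Ioi (0 : ℝ),
    Real.exp (-((2 * u - u ^ 2) / 7) * l ^ 2 + (8 * α / 7) * u * l)

/-- The inner integral of `absorptionIntegral`. -/
def absorptionInner (α u : ℝ) : ℝ :=
  ∫ l in Set.Ioi (0 : ℝ), Real.exp (-((2 * u - u ^ 2) / 7) * l ^ 2 + (8 * α / 7) * u * l)

theorem measurable_absorptionInner (α : ℝ) : Measurable (absorptionInner α) := by
  have h : StronglyMeasurable (Function.uncurry fun u l : ℝ =>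
      Real.exp (-((2 * u - u ^ 2) / 7) * l ^ 2 + (8 * α / 7) * u * l)) :=
    Continuous.stronglyMeasurable (by unfold Function.uncurry; fun_prop)
  exact (h.integral_prod_right (ν := volume.restrict (Set.Ioi (0 : ℝ)))).measurable

theorem absorptionInner_nonneg (α u : ℝ) : 0 ≤ absorptionInner α u :=
  integral_nonneg fun _ => (Real.exp_pos _).le

theorem integrableOn_exp_neg_mul_sq_Ioi {b : ℝ} (hb : 0 < b) :
    IntegrableOn (fun l : ℝ => Real.exp (-b * l ^ 2)) (Set.Ioi 0) :=
  (integrable_exp_neg_mul_sq hb).integrableOn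

theorem integrableOn_absorptionInner_integrand {α u : ℝ} (hα : α ≤ 0) (hu : 0 < u)
    (hu1 : u ≤ 1) :
    IntegrableOn (fun l : ℝ =>
      Real.exp (-((2 * u - u ^ 2) / 7) * l ^ 2 + (8 * α / 7) * u * l)) (Set.Ioi 0) := by
  have hb : 0 < (2 * u - u ^ 2) / 7 := by nlinarith
  refine (integrableOn_exp_neg_mul_sq_Ioi hb).mono'
    (Continuous.aestronglyMeasurable (by fun_prop)) ?_
  filter_upwards [ae_restrict_mem measurableSet_Ioi] with l hl
  have hl : 0 < l := hl
  rw [Real.norm_eq_abs, abs_of_pos (Real.exp_pos _), Real.exp_le_exp]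
  have : 0 ≤ (-α) * (u * l) := by have := neg_nonneg.2 hα; positivity
  nlinarith

theorem absorptionInner_le_rpow {α u : ℝ} (hα : α ≤ 0) (hu : 0 < u) (hu1 : u ≤ 1) :
    absorptionInner α u ≤ √(7 * Real.pi) / 2 * u ^ (-(1 / 2) : ℝ) := by
  have hb : 0 < u / 7 := by positivity
  have h1 : absorptionInner α u ≤ ∫ l in Set.Ioi (0 : ℝ), Real.exp (-(u / 7) * l ^ 2) := by
    refine setIntegral_mono_on (integrableOn_absorptionInner_integrand hα hu hu1)
      (integrableOn_exp_neg_mul_sq_Ioi hb) measurableSet_Ioi fun l hl => ?_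
    have hl : 0 < l := hl
    rw [Real.exp_le_exp]
    have h2 : 0 ≤ (-α) * (u * l) := by have := neg_nonneg.2 hα; positivity
    have h3 : 0 ≤ (u * (1 - u)) * l ^ 2 := by have := sub_nonneg.2 hu1; positivity
    nlinarith
  rw [integral_gaussian_Ioi] at h1
  refine h1.trans_eq ?_
  rw [Real.rpow_neg hu.le, ← Real.sqrt_eq_rpow,
    show Real.pi / (u / 7) = 7 * Real.pi / u by field_simp, Real.sqrt_div (by positivity)]
  ring

theorem integral_exp_neg_mul_Ioi_zero {c : ℝ} (hc : 0 < c) :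
    ∫ l in Set.Ioi (0 : ℝ), Real.exp (-c * l) = 1 / c := by
  rw [integral_exp_mul_Ioi (by linarith) 0]
  simp

theorem integral_sq_mul_exp_neg_mul_Ioi {c : ℝ} (hc : 0 < c) :
    ∫ l in Set.Ioi (0 : ℝ), l ^ 2 * Real.exp (-c * l) = 2 / c ^ 3 := by
  have h := Real.integral_rpow_mul_exp_neg_mul_Ioi (a := 3) (r := c) (by norm_num) hc
  have hG : Real.Gamma 3 = 2 := by
    rw [show (3 : ℝ) = (2 : ℕ) + 1 by norm_num, Real.Gamma_nat_eq_factorial]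
    rfl
  rw [hG, show (3 : ℝ) - 1 = (2 : ℕ) by norm_num, show (3 : ℝ) = (3 : ℕ) by norm_num] at h
  simp only [Real.rpow_natCast, ← neg_mul] at h
  rw [h]
  field_simp

theorem integrableOn_exp_neg_mul_Ioi {c : ℝ} (hc : 0 < c) :
    IntegrableOn (fun l : ℝ => Real.exp (-c * l)) (Set.Ioi 0) :=
  integrableOn_exp_mul_Ioi (by linarith) 0

theorem integrableOn_sq_mul_exp_neg_mul_Ioi {c : ℝ} (hc : 0 < c) :
    IntegrableOn (fun l : ℝ => l ^ 2 * Real.exp (-c * l)) (Set.Ioi 0) := by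
  by_contra h
  have h2 := integral_sq_mul_exp_neg_mul_Ioi hc
  rw [integral_undef h] at h2
  have : 0 < 2 / c ^ 3 := by positivity
  linarith

theorem absorptionInner_neg_le {a u : ℝ} (ha : 0 < a) (hu : 0 < u) (hu1 : u ≤ 1) :
    absorptionInner (-a) u ≤ 7 / (8 * a) * u⁻¹ := by
  have hc : 0 < 8 * a / 7 * u := by positivity
  have h1 : absorptionInner (-a) u ≤ ∫ l in Set.Ioi (0 : ℝ), Real.exp (-(8 * a / 7 * u) * l) := by
    refine setIntegral_mono_on (integrableOn_absorptionInner_integrand (by linarith) hu hu1)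
      (integrableOn_exp_neg_mul_Ioi hc) measurableSet_Ioi fun l _ => ?_
    rw [Real.exp_le_exp]
    have h3 : 0 ≤ (u * (2 - u)) * l ^ 2 := by
      have : 0 ≤ 2 - u := by linarith
      positivity
    nlinarith
  rw [integral_exp_neg_mul_Ioi_zero hc] at h1
  refine h1.trans_eq ?_
  field_simp

theorem le_absorptionInner_neg {a u : ℝ} (ha : 0 < a) (hu : 0 < u) (hu1 : u ≤ 1) :
    7 / (8 * a) * u⁻¹ - 49 / 128 / a ^ 3 * (u ^ 2)⁻¹ ≤ absorptionInner (-a) u := by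
  have hc : 0 < 8 * a / 7 * u := by positivity
  have h1 : ∫ l in Set.Ioi (0 : ℝ), (Real.exp (-(8 * a / 7 * u) * l)
      - 2 * u / 7 * (l ^ 2 * Real.exp (-(8 * a / 7 * u) * l))) ≤ absorptionInner (-a) u := by
    refine setIntegral_mono_on ((integrableOn_exp_neg_mul_Ioi hc).sub
      ((integrableOn_sq_mul_exp_neg_mul_Ioi hc).const_mul _))
      (integrableOn_absorptionInner_integrand (by linarith) hu hu1) measurableSet_Ioi
      fun l _ => ?_
    rw [Real.exp_add, show 8 * -a / 7 * u * l = -(8 * a / 7 * u) * l by ring]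
    have h2 := Real.add_one_le_exp (-((2 * u - u ^ 2) / 7) * l ^ 2)
    have h3 : 0 ≤ u ^ 2 * l ^ 2 := by positivity
    have h4 : 1 - 2 * u / 7 * l ^ 2 ≤ Real.exp (-((2 * u - u ^ 2) / 7) * l ^ 2) := by
      nlinarith
    have h5 := mul_le_mul_of_nonneg_right h4 (Real.exp_pos (-(8 * a / 7 * u) * l)).le
    linarith
  rw [integral_sub (integrableOn_exp_neg_mul_Ioi hc)
    ((integrableOn_sq_mul_exp_neg_mul_Ioi hc).const_mul _), integral_const_mul,
    integral_exp_neg_mul_Ioi_zero hc, integral_sq_mul_exp_neg_mul_Ioi hc] at h1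
  refine le_of_eq_of_le ?_ h1
  field_simp
  ring

theorem intervalIntegrable_absorptionInner {α : ℝ} (hα : α ≤ 0) :
    IntervalIntegrable (absorptionInner α) volume 0 1 := by
  have h : IntervalIntegrable (fun u : ℝ => √(7 * Real.pi) / 2 * u ^ (-(1 / 2) : ℝ)) volume 0 1 :=
    (intervalIntegral.intervalIntegrable_rpow' (by norm_num)).const_mul _
  refine h.mono_fun' (measurable_absorptionInner α).aestronglyMeasurable ?_
  filter_upwards [ae_restrict_mem measurableSet_uIoc] with u hu
  rw [Set.uIoc_of_le zero_le_one] at hu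
  rw [Real.norm_eq_abs, abs_of_nonneg (absorptionInner_nonneg α u)]
  exact absorptionInner_le_rpow hα hu.1 hu.2

theorem absorptionIntegral_neg_bounds {a : ℝ} (ha : 1 < a) :
    7 / 4 * (Real.log a / a) - 49 / 128 / a ≤ absorptionIntegral (-a) ∧
      absorptionIntegral (-a) ≤ 7 / 4 * (Real.log a / a) + √(7 * Real.pi) / a := by
  have ha0 : 0 < a := by linarith
  set δ : ℝ := (a ^ 2)⁻¹ with hδ
  have hδ0 : 0 < δ := by positivity
  have hδ1 : δ ≤ 1 := inv_le_one_of_one_le₀ (by nlinarith)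
  have hint := intervalIntegrable_absorptionInner (α := -a) (by linarith)
  have hint1 : IntervalIntegrable (absorptionInner (-a)) volume 0 δ :=
    hint.mono_set (by
      rw [Set.uIcc_of_le hδ0.le, Set.uIcc_of_le zero_le_one]
      exact Set.Icc_subset_Icc_right hδ1)
  have hint2 : IntervalIntegrable (absorptionInner (-a)) volume δ 1 :=
    hint.mono_set (by
      rw [Set.uIcc_of_le hδ1, Set.uIcc_of_le zero_le_one]
      exact Set.Icc_subset_Icc_left hδ0.le)
  have hsplit : absorptionIntegral (-a) =
      (∫ u in (0 : ℝ)..δ, absorptionInner (-a) u) + ∫ u in δ..1, absorptionInner (-a) u :=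
    (intervalIntegral.integral_add_adjacent_intervals hint1 hint2).symm
  have h0 : (0 : ℝ) ∉ Set.uIcc δ 1 := Set.notMem_uIcc_of_lt hδ0 one_pos
  have hinv : IntervalIntegrable (fun u : ℝ => 7 / (8 * a) * u⁻¹) volume δ 1 :=
    (intervalIntegrable_inv_iff.2 (Or.inr h0)).const_mul _
  have hinvsq : IntervalIntegrable (fun u : ℝ => 49 / 128 / a ^ 3 * (u ^ 2)⁻¹) volume δ 1 := by
    refine ContinuousOn.intervalIntegrable (continuousOn_const.mul
      ((continuousOn_id.pow 2).inv₀ fun u hu => ?_))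
    have : u ≠ 0 := fun h => h0 (h ▸ hu)
    simpa using this
  have hlog : ∫ u in δ..1, 7 / (8 * a) * u⁻¹ = 7 / 4 * (Real.log a / a) := by
    rw [intervalIntegral.integral_const_mul, integral_inv h0, hδ, one_div, inv_inv, Real.log_pow]
    push_cast
    field_simp
    ring
  have hsq : ∫ u in δ..1, 49 / 128 / a ^ 3 * (u ^ 2)⁻¹ = 49 / 128 / a ^ 3 * (a ^ 2 - 1) := by
    have h := integral_zpow (a := δ) (b := 1) (n := -2) (Or.inr ⟨by norm_num, h0⟩)
    rw [intervalIntegral.integral_const_mul]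
    congr 1
    calc ∫ u in δ..1, (u ^ 2)⁻¹ = ∫ u in δ..1, u ^ (-2 : ℤ) := by
          congr 1
      _ = a ^ 2 - 1 := by
          rw [h, hδ]
          norm_num
          ring
  constructor
  · have hlow : ∫ u in δ..1, (7 / (8 * a) * u⁻¹ - 49 / 128 / a ^ 3 * (u ^ 2)⁻¹) ≤
        ∫ u in δ..1, absorptionInner (-a) u :=
      intervalIntegral.integral_mono_on hδ1 (hinv.sub hinvsq) hint2 fun u hu =>
        le_absorptionInner_neg ha0 (hδ0.trans_le hu.1) hu.2
    rw [intervalIntegral.integral_sub hinv hinvsq, hlog, hsq] at hlow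
    have hnonneg : 0 ≤ ∫ u in (0 : ℝ)..δ, absorptionInner (-a) u :=
      intervalIntegral.integral_nonneg hδ0.le fun u _ => absorptionInner_nonneg _ u
    have hrem : 49 / 128 / a ^ 3 * (a ^ 2 - 1) ≤ 49 / 128 / a := by
      have : 49 / 128 / a - 49 / 128 / a ^ 3 * (a ^ 2 - 1) = 49 / 128 / a ^ 3 := by
        field_simp
        ring
      have : 0 < 49 / 128 / a ^ 3 := by positivity
      linarith
    linarith
  · have hup : ∫ u in δ..1, absorptionInner (-a) u ≤ ∫ u in δ..1, 7 / (8 * a) * u⁻¹ :=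
      intervalIntegral.integral_mono_on hδ1 hint2 hinv fun u hu =>
        absorptionInner_neg_le ha0 (hδ0.trans_le hu.1) hu.2
    have hsmall : ∫ u in (0 : ℝ)..δ, absorptionInner (-a) u ≤
        ∫ u in (0 : ℝ)..δ, √(7 * Real.pi) / 2 * u ^ (-(1 / 2) : ℝ) :=
      intervalIntegral.integral_mono_on_of_le_Ioo hδ0.le hint1
        ((intervalIntegral.intervalIntegrable_rpow' (by norm_num)).const_mul _) fun u hu =>
        absorptionInner_le_rpow (by linarith) hu.1 (hu.2.le.trans hδ1)
    have hrpow : ∫ u in (0 : ℝ)..δ, √(7 * Real.pi) / 2 * u ^ (-(1 / 2) : ℝ) =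
        √(7 * Real.pi) / a := by
      rw [intervalIntegral.integral_const_mul, integral_rpow (Or.inl (by norm_num)),
        show (-(1 / 2) : ℝ) + 1 = 1 / 2 by norm_num, ← Real.sqrt_eq_rpow, hδ, Real.sqrt_inv,
        Real.sqrt_sq ha0.le, Real.zero_rpow (by norm_num)]
      field_simp
      ring
    linarith

/-- As `α → -∞`, `(|α|/ln|α|) I(α) → 7/4`; equivalently
`E[T_α] = (4/7) I(α) ∼ ln|α|/|α|`. -/
theorem absorptionIntegral_asymptotic_bot :
    Tendsto (fun α : ℝ => (|α| / Real.log |α|) * absorptionIntegral α)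
      atBot (𝓝 (7 / 4 : ℝ)) := by
  have hlog : Tendsto (fun α : ℝ => Real.log |α|) atBot atTop :=
    Real.tendsto_log_atTop.comp tendsto_abs_atBot_atTop
  have hlow : Tendsto (fun α : ℝ => 7 / 4 - 49 / 128 / Real.log |α|) atBot (𝓝 (7 / 4)) := by
    simpa using tendsto_const_nhds.sub (hlog.const_div_atTop (49 / 128))
  have hup : Tendsto (fun α : ℝ => 7 / 4 + √(7 * Real.pi) / Real.log |α|) atBot
      (𝓝 (7 / 4)) := by
    simpa using tendsto_const_nhds.add (hlog.const_div_atTop (√(7 * Real.pi)))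
  have hbounds : ∀ᶠ α : ℝ in atBot,
      7 / 4 - 49 / 128 / Real.log |α| ≤ (|α| / Real.log |α|) * absorptionIntegral α ∧
      (|α| / Real.log |α|) * absorptionIntegral α ≤ 7 / 4 + √(7 * Real.pi) / Real.log |α| := by
    filter_upwards [eventually_lt_atBot (-1)] with α hα
    obtain ⟨a, rfl⟩ : ∃ a, α = -a := ⟨-α, by ring⟩
    have ha : 1 < a := by linarith
    have ha0 : 0 < a := by linarith
    rw [abs_neg, abs_of_pos ha0]
    have hl : 0 < Real.log a := Real.log_pos ha
    have hq : 0 ≤ a / Real.log a := by positivity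
    obtain ⟨h1, h2⟩ := absorptionIntegral_neg_bounds ha
    refine ⟨le_of_eq_of_le ?_ (mul_le_mul_of_nonneg_left h1 hq),
      (mul_le_mul_of_nonneg_left h2 hq).trans_eq ?_⟩ <;> field_simp
  exact tendsto_of_tendsto_of_tendsto_of_le_of_le' hlow hup
    (hbounds.mono fun _ h => h.1) (hbounds.mono fun _ h => h.2)

end
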